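/- Every unitary C in the third level C^(3) of the Clifford hierarchy is a generalized semi-Clifford matrix: there exist maximal commutative subgroups S_1 and S_2 of the Pauli group such that C maps the complex linear span of S_1 onto the complex linear span of S_2 under conjugation, i.e., C · span(S_1) · C† = span(S_2). -/

import Mathlib

open Matrix
open scoped Classical

noncomputable section

abbrev V (m : ℕ) := Fin m → ZMod 2

/-- Integer dot product of two binary vectors (using {0,1} representatives). -/
def dotN {m : ℕ} (a b : V m) : ℕ := ∑ i, (a i).val * (b i).val

/-- The matrix `D(a,b)` with `D(a,b)|v⟩ = (−1)^{b·v}|v⊕a⟩`. -/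
def DM {m : ℕ} (a b : V m) : Matrix (V m) (V m) ℂ :=
  Matrix.of fun u v => if u = v + a then (-1 : ℂ) ^ dotN b v else 0

/-- The Hermitian Pauli `E(a,b) = i^{a·b mod 4} D(a,b)`, for `c = (a,b) ∈ F_2^{2m}`. -/
def EM {m : ℕ} (c : V m × V m) : Matrix (V m) (V m) ℂ :=
  Complex.I ^ dotN c.1 c.2 • DM c.1 c.2

/-- The Heisenberg–Weyl group `HW_N = {i^k D(a,b)}`, as a set of matrices. -/
def HW (m : ℕ) : Set (Matrix (V m) (V m) ℂ) :=
  {M | ∃ (k : Fin 4) (a b : V m), M = Complex.I ^ (k : ℕ) • DM a b}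

/-- A Clifford matrix: a unitary normalizing the Heisenberg–Weyl group. -/
def IsClifford {m : ℕ} (G : Matrix (V m) (V m) ℂ) : Prop :=
  G ∈ Matrix.unitaryGroup (V m) ℂ ∧ ∀ W ∈ HW m, G * W * Gᴴ ∈ HW m

/-- The (Pauli/Weyl) support of a matrix, identified with vectors in `F_2^{2m}`. -/
def supp {m : ℕ} (M : Matrix (V m) (V m) ℂ) : Set (V m × V m) :=
  {c | Matrix.trace ((EM c)ᴴ * M) ≠ 0}

/-- The symplectic inner product on `F_2^{2m}`. -/
def sympl {m : ℕ} (u v : V m × V m) : ZMod 2 :=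
  ∑ i, (u.1 i * v.2 i + u.2 i * v.1 i)

/-- The Clifford hierarchy; `CH m k` is the `(k+1)`-st level `C^(k+1)`, so
`CH m 0 = HW_N = C^(1)` and `C^(3) = CH m 2`. -/
def CH (m : ℕ) : ℕ → Set (Matrix (V m) (V m) ℂ)
  | 0 => HW m
  | k + 1 => {U | U ∈ Matrix.unitaryGroup (V m) ℂ ∧ ∀ W ∈ HW m, U * W * Uᴴ ∈ CH m k}


/-! Proof: a maximal isotropic subspace invariant under the commuting symplectic involutions
induced by the Cliffords `C E(c) C†` exists; pulling it back through `C` gives `J1`. -/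

def sg (x : ZMod 2) : ℂ := (-1 : ℂ) ^ x.val

lemma sg_zero : sg 0 = 1 := by simp [sg]
lemma sg_one : sg 1 = -1 := by
  have : (1 : ZMod 2).val = 1 := rfl
  simp [sg, this]

lemma z2_cases (x : ZMod 2) : x = 0 ∨ x = 1 := by
  revert x; decide

lemma sg_add (x y : ZMod 2) : sg (x + y) = sg x * sg y := by
  have h11 : (1 + 1 : ZMod 2) = 0 := by decide
  rcases z2_cases x with rfl | rfl <;> rcases z2_cases y with rfl | rfl <;>
    simp [sg_zero, sg_one, h11]

lemma sg_eq_one {x : ZMod 2} (h : sg x = 1) : x = 0 := by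
  rcases z2_cases x with rfl | rfl
  · rfl
  · rw [sg_one] at h; norm_num at h

lemma sg_ne (x : ZMod 2) : sg x ≠ 0 := by simp [sg]

lemma sg_sq (x : ZMod 2) : sg x * sg x = 1 := by
  rcases z2_cases x with rfl | rfl <;> simp [sg_zero, sg_one]

lemma sg_natCast (n : ℕ) : sg (n : ZMod 2) = (-1) ^ n := by
  induction n with
  | zero => simp [sg_zero]
  | succ k ih => rw [Nat.cast_succ, sg_add, ih, pow_succ, Nat.cast_one.symm, Nat.cast_one, sg_one]

lemma neg_one_pow_dotN {m : ℕ} (a b : V m) : (-1 : ℂ) ^ dotN a b = sg (∑ i, a i * b i) := by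
  rw [← sg_natCast]; simp [dotN]

lemma v_add_self {m : ℕ} (a : V m) : a + a = 0 := by
  funext i
  have : ∀ x : ZMod 2, x + x = 0 := by decide
  exact this _

lemma vv_add_self {m : ℕ} (a : V m × V m) : a + a = 0 := by
  ext i <;> simp [CharTwo.add_self_eq_zero]

def dt {m : ℕ} (a b : V m) : ZMod 2 := ∑ i, a i * b i

lemma dt_add_left {m : ℕ} (a b c : V m) : dt (a + b) c = dt a c + dt b c := by
  simp [dt, add_mul, Finset.sum_add_distrib]
lemma dt_add_right {m : ℕ} (a b c : V m) : dt a (b + c) = dt a b + dt a c := by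
  simp [dt, mul_add, Finset.sum_add_distrib]
lemma dt_comm {m : ℕ} (a b : V m) : dt a b = dt b a := by
  simp [dt, mul_comm]
lemma dt_zero_left {m : ℕ} (b : V m) : dt 0 b = 0 := by simp [dt]
lemma dt_single {m : ℕ} (i : Fin m) (b : V m) : dt (Pi.single i 1) b = b i := by
  simp [dt, Pi.single_apply]

lemma DM_apply {m : ℕ} (a b u v : V m) :
    DM a b u v = if u = v + a then sg (dt b v) else 0 := by
  simp [DM, neg_one_pow_dotN, dt]

lemma DM_mul {m : ℕ} (a b a' b' : V m) :
    DM a b * DM a' b' = sg (dt b a') • DM (a + a') (b + b') := by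
  ext u v
  rw [Matrix.mul_apply, Matrix.smul_apply]
  simp only [DM_apply]
  rw [Finset.sum_eq_single (v + a')]
  · have : v + a' + a = v + (a + a') := by abel
    rw [this]
    by_cases h : u = v + (a + a')
    · simp only [h, if_true, dt_add_left, dt_add_right, sg_add, smul_eq_mul]; ring
    · simp [h]
  · intro w _ hw; simp [hw]
  · simp

lemma DM_zero {m : ℕ} : (DM 0 0 : Matrix (V m) (V m) ℂ) = 1 := by
  ext u v
  simp [DM_apply, dt_zero_left, sg_zero, Matrix.one_apply]

lemma sympl_eq {m : ℕ} (c d : V m × V m) : sympl c d = dt c.1 d.2 + dt c.2 d.1 := by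
  simp [sympl, dt, Finset.sum_add_distrib]

lemma sympl_comm {m : ℕ} (c d : V m × V m) : sympl c d = sympl d c := by
  rw [sympl_eq, sympl_eq, dt_comm c.1, dt_comm c.2, add_comm]
lemma sympl_add_left {m : ℕ} (c c' d : V m × V m) :
    sympl (c + c') d = sympl c d + sympl c' d := by
  simp only [sympl_eq, Prod.fst_add, Prod.snd_add, dt_add_left]; ring
lemma sympl_add_right {m : ℕ} (d c c' : V m × V m) :
    sympl d (c + c') = sympl d c + sympl d c' := by
  simp only [sympl_comm d, sympl_add_left]
lemma sympl_self {m : ℕ} (c : V m × V m) : sympl c c = 0 := by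
  rw [sympl_eq, dt_comm c.1]; exact CharTwo.add_self_eq_zero _
lemma sympl_zero_left {m : ℕ} (c : V m × V m) : sympl 0 c = 0 := by
  simp [sympl]
lemma sympl_zero_right {m : ℕ} (c : V m × V m) : sympl c 0 = 0 := by
  simp [sympl]

lemma sympl_nondeg {m : ℕ} (c : V m × V m) (h : ∀ d, sympl d c = 0) : c = 0 := by
  ext i
  · have := h (0, Pi.single i 1)
    rw [sympl_eq] at this
    simpa [dt_single, dt_zero_left] using this
  · have := h (Pi.single i 1, 0)
    rw [sympl_eq] at this
    simpa [dt_single, dt_zero_left] using this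

lemma EM_mul {m : ℕ} (c d : V m × V m) :
    ∃ z : ℂ, z ≠ 0 ∧ EM c * EM d = z • EM (c + d) := by
  refine ⟨Complex.I ^ dotN c.1 c.2 * Complex.I ^ dotN d.1 d.2 * sg (dt c.2 d.1) *
    (Complex.I ^ dotN (c + d).1 (c + d).2)⁻¹, ?_, ?_⟩
  · simp [sg_ne, Complex.I_ne_zero]
  · have hI : Complex.I ^ dotN (c + d).1 (c + d).2 ≠ 0 := by simp [Complex.I_ne_zero]
    simp only [EM, Matrix.smul_mul, Matrix.mul_smul, DM_mul, smul_smul]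
    congr 1
    rw [mul_assoc _ _ (Complex.I ^ _), inv_mul_cancel₀ hI, mul_one]; ring

lemma EM_comm {m : ℕ} (c d : V m × V m) :
    EM c * EM d = sg (sympl c d) • (EM d * EM c) := by
  simp only [EM, Matrix.smul_mul, Matrix.mul_smul, DM_mul, smul_smul]
  rw [add_comm d.1, add_comm d.2, sympl_eq, sg_add, dt_comm c.1]
  congr 1
  have := sg_sq (dt d.2 c.1)
  linear_combination (-(Complex.I ^ dotN c.1 c.2 * Complex.I ^ dotN d.1 d.2 * sg (dt c.2 d.1))) * this

lemma EM_zero {m : ℕ} : (EM 0 : Matrix (V m) (V m) ℂ) = 1 := by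
  simp [EM, dotN, DM_zero]

lemma EM_sq {m : ℕ} (c : V m × V m) : EM c * EM c = 1 := by
  simp only [EM, Matrix.smul_mul, Matrix.mul_smul, DM_mul, smul_smul, v_add_self, DM_zero]
  rw [← mul_assoc, ← mul_pow, Complex.I_mul_I, neg_one_pow_dotN, dt_comm c.2]
  change (sg (dt _ _) * sg _) • _ = _
  rw [sg_sq, one_smul]

lemma EM_ne {m : ℕ} (c : V m × V m) : EM c ≠ 0 := by
  intro h
  have := EM_sq c
  rw [h] at this
  simp at this

lemma EM_mem_HW {m : ℕ} (c : V m × V m) : EM c ∈ HW m := by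
  refine ⟨⟨dotN c.1 c.2 % 4, Nat.mod_lt _ (by norm_num)⟩, c.1, c.2, ?_⟩
  rw [EM, Complex.I_pow_eq_pow_mod]

lemma HW_eq {m : ℕ} {W : Matrix (V m) (V m) ℂ} (h : W ∈ HW m) :
    ∃ (z : ℂ) (c : V m × V m), z ≠ 0 ∧ W = z • EM c := by
  obtain ⟨k, a, b, rfl⟩ := h
  refine ⟨Complex.I ^ (k : ℕ) * (Complex.I ^ dotN a b)⁻¹, (a, b), ?_, ?_⟩
  · simp [Complex.I_ne_zero]
  · have hI : Complex.I ^ dotN a b ≠ 0 := by simp [Complex.I_ne_zero]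
    simp only [EM, smul_smul]
    rw [mul_assoc, inv_mul_cancel₀ hI, mul_one]

lemma EM_inj {m : ℕ} {z w : ℂ} {c d : V m × V m} (hz : z ≠ 0)
    (h : z • EM c = w • EM d) : c = d := by
  have key : ∀ e, sympl e (c + d) = 0 := by
    intro e
    have h1 : EM e * (z • EM c) = sg (sympl e c) • ((z • EM c) * EM e) := by
      rw [Matrix.mul_smul, EM_comm, Matrix.smul_mul, smul_comm]
    have h2 : EM e * (z • EM c) = sg (sympl e d) • ((z • EM c) * EM e) := by
      rw [h, Matrix.mul_smul, EM_comm, Matrix.smul_mul, smul_comm]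
    have h3 : (z • EM c) * EM e ≠ 0 := by
      intro h0
      have := congrArg (· * EM e) h0
      simp only [mul_assoc, EM_sq, mul_one, zero_mul, smul_eq_zero] at this
      exact this.elim hz (EM_ne c)
    have h4 : sg (sympl e c) = sg (sympl e d) := by
      rw [h1] at h2
      exact smul_left_injective ℂ h3 h2
    apply sg_eq_one
    rw [sympl_add_right, sg_add, h4, sg_sq]
  have := sympl_nondeg _ key
  calc c = c + (d + d) := by rw [vv_add_self, add_zero]
    _ = d := by rw [← add_assoc, this, zero_add]

lemma scalar_of_commute {m : ℕ} (M : Matrix (V m) (V m) ℂ)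
    (h : ∀ c, EM c * M = M * EM c) : M = (M 0 0) • (1 : Matrix (V m) (V m) ℂ) := by
  have hD : ∀ a b, DM a b * M = M * DM a b := by
    intro a b
    have := h (a, b)
    simp only [EM, Matrix.smul_mul, Matrix.mul_smul] at this
    have hI : Complex.I ^ dotN a b ≠ 0 := by simp [Complex.I_ne_zero]
    exact smul_right_injective _ hI this
  ext u v
  rw [Matrix.smul_apply, Matrix.one_apply]
  by_cases huv : u = v
  · subst huv
    have h1 := congrFun (congrFun (hD u 0) u) 0
    rw [Matrix.mul_apply, Matrix.mul_apply, Finset.sum_eq_single 0, Finset.sum_eq_single u] at h1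
    · simpa [DM_apply, dt_zero_left, sg_zero] using h1.symm
    · intro w _ hw; simp [DM_apply, hw]
    · simp
    · intro w _ hw; simp [DM_apply, hw, eq_comm]
    · simp
  · rw [if_neg huv, smul_zero]
    obtain ⟨i, hi⟩ := Function.ne_iff.mp huv
    have h1 := congrFun (congrFun (hD 0 (Pi.single i 1)) u) v
    rw [Matrix.mul_apply, Matrix.mul_apply, Finset.sum_eq_single u, Finset.sum_eq_single v] at h1
    · simp only [DM_apply, add_zero, if_true, dt_single] at h1
      by_contra hne
      have h2 : sg (u i) = sg (v i) := by
        apply mul_right_cancel₀ hne; rw [h1, mul_comm]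
      apply hi
      have h3 : u i + v i = 0 := by
        apply sg_eq_one; rw [sg_add, h2, sg_sq]
      exact CharTwo.add_eq_zero.mp h3
    · intro w _ hw; simp [DM_apply, hw]
    · simp
    · intro w _ hw; simp [DM_apply, Ne.symm hw]
    · simp

/-- conjugation by a Pauli -/
def cj {m : ℕ} (e : V m × V m) (X : Matrix (V m) (V m) ℂ) : Matrix (V m) (V m) ℂ :=
  EM e * X * EM e

lemma cj_cj {m : ℕ} (e d : V m × V m) (X : Matrix (V m) (V m) ℂ) :
    cj e (cj d X) = cj (e + d) X := by
  obtain ⟨z, hz, h1⟩ := EM_mul e d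
  obtain ⟨w, hw, h2⟩ := EM_mul d e
  have h3 : z * w = 1 := by
    have h4 : (EM e * EM d) * (EM d * EM e) = 1 := by
      rw [mul_assoc, ← mul_assoc (EM d), EM_sq, one_mul, EM_sq]
    rw [h1, h2, add_comm d e, Matrix.smul_mul, Matrix.mul_smul, EM_sq, smul_smul] at h4
    have := congrFun (congrFun h4 0) 0
    simpa using this
  calc cj e (cj d X) = (EM e * EM d) * X * (EM d * EM e) := by simp only [cj, mul_assoc]
    _ = cj (e + d) X := by
      rw [h1, h2, add_comm d e, Matrix.smul_mul, Matrix.smul_mul, Matrix.mul_smul, smul_smul, h3,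
        one_smul, cj]

def PP {m : ℕ} (c : V m × V m) (X : Matrix (V m) (V m) ℂ) : Matrix (V m) (V m) ℂ :=
  ∑ d, sg (sympl c d) • cj d X

lemma cj_PP {m : ℕ} (c e : V m × V m) (X : Matrix (V m) (V m) ℂ) :
    cj e (PP c X) = ∑ d, sg (sympl c d) • cj (e + d) X := by
  have : cj e (PP c X) = ∑ d, sg (sympl c d) • cj e (cj d X) := by
    simp only [PP, cj, Finset.mul_sum, Finset.sum_mul, Matrix.mul_smul, Matrix.smul_mul]
  rw [this]; simp only [cj_cj]

lemma PP_cj {m : ℕ} (c e : V m × V m) (X : Matrix (V m) (V m) ℂ) :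
    PP c (cj e X) = cj e (PP c X) := by
  rw [cj_PP]; simp only [PP, cj_cj, add_comm]

lemma cj_PP' {m : ℕ} (c e : V m × V m) (X : Matrix (V m) (V m) ℂ) :
    cj e (PP c X) = sg (sympl c e) • PP c X := by
  rw [cj_PP, PP, Finset.smul_sum]
  refine Fintype.sum_equiv (Equiv.addLeft e) _ _ ?_
  intro d
  simp only [Equiv.coe_addLeft, smul_smul]
  rw [sympl_add_right, sg_add, ← mul_assoc, sg_sq, one_mul]

lemma PP_scalar {m : ℕ} (c : V m × V m) (X : Matrix (V m) (V m) ℂ) :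
    ∃ z : ℂ, PP c X = z • EM c := by
  have h := scalar_of_commute (PP c X * EM c) ?_
  · refine ⟨(PP c X * EM c) 0 0, ?_⟩
    · have h2 := congrArg (· * EM c) h
      simpa only [mul_assoc, EM_sq, mul_one, Matrix.smul_mul, one_mul] using h2
  · intro e
    have h1 : EM e * PP c X = sg (sympl c e) • (PP c X * EM e) := by
      have := congrArg (· * EM e) (cj_PP' c e X)
      simpa only [cj, mul_assoc, EM_sq, mul_one, Matrix.smul_mul] using this
    rw [← mul_assoc, h1, Matrix.smul_mul, mul_assoc, EM_comm e c, Matrix.mul_smul, smul_smul,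
      sympl_comm e c, sg_sq, one_smul, mul_assoc]

lemma sum_sg {m : ℕ} (d : V m × V m) (hd : d ≠ 0) : ∑ c, sg (sympl c d) = 0 := by
  have : ∃ e, sympl e d ≠ 0 := by
    by_contra! h; exact hd (sympl_nondeg d h)
  obtain ⟨e, he⟩ := this
  have he1 : sympl e d = 1 := (z2_cases _).resolve_left he
  have h : ∑ c, sg (sympl c d) = ∑ c, sg (sympl (e + c) d) :=
    (Equiv.sum_comp (Equiv.addLeft e) (fun c => sg (sympl c d))).symm
  simp only [sympl_add_left, sg_add, he1, sg_one, ← Finset.mul_sum] at h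
  linear_combination h / 2

lemma sum_PP {m : ℕ} (X : Matrix (V m) (V m) ℂ) :
    ∑ c, PP c X = (Fintype.card (V m × V m) : ℂ) • X := by
  simp only [PP]
  rw [Finset.sum_comm]
  simp only [← Finset.sum_smul]
  rw [Finset.sum_eq_single 0]
  · simp [sympl_zero_right, sg_zero, cj, EM_zero]
  · intro d _ hd; rw [sum_sg d hd, zero_smul]
  · simp

lemma mem_of_PP {m : ℕ} (X : Matrix (V m) (V m) ℂ)
    (S : Submodule ℂ (Matrix (V m) (V m) ℂ)) (h : ∀ c, PP c X ∈ S) : X ∈ S := by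
  have h1 := S.sum_mem (t := Finset.univ) (fun c _ => h c)
  rw [sum_PP] at h1
  exact (S.smul_mem_iff (by simp)).mp h1

/-- the span of the Paulis of a self-dual subspace is its own commutant -/
lemma mem_span_iff {m : ℕ} (J : Submodule (ZMod 2) (V m × V m))
    (h1 : ∀ u ∈ J, ∀ v ∈ J, sympl u v = 0)
    (h2 : ∀ w : V m × V m, (∀ v ∈ J, sympl w v = 0) → w ∈ J) (M : Matrix (V m) (V m) ℂ) :
    M ∈ Submodule.span ℂ (EM '' (J : Set (V m × V m))) ↔ ∀ j ∈ J, cj j M = M := by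
  constructor
  · intro hM j hj
    induction hM using Submodule.span_induction with
    | mem x hx =>
      obtain ⟨c, hc, rfl⟩ := hx
      rw [cj, EM_comm, h1 j hj c hc, sg_zero, one_smul, mul_assoc, EM_sq, mul_one]
    | zero => simp [cj]
    | add x y _ _ hx hy =>
      simp only [cj] at *
      rw [mul_add, add_mul, hx, hy]
    | smul a x _ hx =>
      simp only [cj] at *
      rw [Matrix.mul_smul, Matrix.smul_mul, hx]
  · intro hM
    apply mem_of_PP
    intro c
    by_cases hc : c ∈ J
    · obtain ⟨z, hz⟩ := PP_scalar c M
      rw [hz]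
      exact Submodule.smul_mem _ _ (Submodule.subset_span ⟨c, hc, rfl⟩)
    · have : ∃ v ∈ J, sympl c v ≠ 0 := by
        by_contra! h; exact hc (h2 c h)
      obtain ⟨v, hv, hcv⟩ := this
      have h3 := cj_PP' c v M
      rw [← PP_cj, hM v hv, (z2_cases _).resolve_left hcv, sg_one, neg_one_smul] at h3
      have h4 : PP c M = 0 := by
        ext u v
        have h5 := congrFun (congrFun h3 u) v
        rw [Matrix.neg_apply] at h5
        exact self_eq_neg.mp h5
      rw [h4]; exact Submodule.zero_mem _

/-- existence of an invariant self-dual subspace -/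
lemma exists_invariant {m : ℕ} {ι : Type} [Finite ι] (F : ι → (V m × V m) → (V m × V m))
    (Fadd : ∀ i x y, F i (x + y) = F i x + F i y)
    (Fsym : ∀ i x y, sympl (F i x) (F i y) = sympl x y)
    (Fsq : ∀ i x, F i (F i x) = x)
    (Fcomm : ∀ i j x, F i (F j x) = F j (F i x)) :
    ∃ J : Submodule (ZMod 2) (V m × V m), (∀ u ∈ J, ∀ v ∈ J, sympl u v = 0) ∧
      (∀ w : V m × V m, (∀ v ∈ J, sympl w v = 0) → w ∈ J) ∧ ∀ i, ∀ x ∈ J, F i x ∈ J := by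
  have F0 : ∀ i, F i 0 = 0 := by
    intro i
    have := Fadd i 0 0
    simpa using this
  let P : Set (Submodule (ZMod 2) (V m × V m)) :=
    {J | (∀ u ∈ J, ∀ v ∈ J, sympl u v = 0) ∧ ∀ i, ∀ x ∈ J, F i x ∈ J}
  have hP : P.Nonempty := by
    refine ⟨⊥, ?_, ?_⟩
    · intro u hu v _
      rw [(Submodule.mem_bot _).mp hu, sympl_zero_left]
    · intro i x hx
      rw [(Submodule.mem_bot _).mp hx, F0]; exact Submodule.zero_mem _
  obtain ⟨J, ⟨hJ1, hJ2⟩, hmax⟩ := WellFounded.has_min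
    (wellFounded_gt : WellFounded ((· > ·) : Submodule (ZMod 2) (V m × V m) → _ → Prop)) P hP
  refine ⟨J, hJ1, ?_, hJ2⟩
  by_contra! hcon
  let Q := {w : V m × V m // (∀ v ∈ J, sympl w v = 0) ∧ w ∉ J}
  have hQ : Nonempty Q := by
    obtain ⟨w, h1, h2⟩ := hcon
    exact ⟨⟨w, h1, h2⟩⟩
  obtain ⟨⟨w, hw1, hw2⟩, hwmax⟩ :=
    Finite.exists_max (fun w : Q => Set.ncard {i : ι | F i w.1 + w.1 ∈ J})
  have hfix : ∀ i, F i w + w ∈ J := by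
    by_contra! hno
    obtain ⟨i, hi⟩ := hno
    have hw' : ∀ v ∈ J, sympl (F i w + w) v = 0 := by
      intro v hv
      rw [sympl_add_left, hw1 v hv, add_zero, ← Fsq i v, Fsym]
      exact hw1 _ (hJ2 i v hv)
    have h1 := hwmax ⟨F i w + w, hw', hi⟩
    refine absurd h1 (not_le.mpr (Set.ncard_lt_ncard ?_ (Set.toFinite _)))
    refine (Set.ssubset_iff_of_subset ?_).mpr ⟨i, ?_, hi⟩
    · intro j hj
      simp only [Set.mem_setOf_eq] at hj ⊢
      have : F j (F i w + w) + (F i w + w) = F i (F j w + w) + (F j w + w) := by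
        rw [Fadd, Fadd, Fcomm j i]; abel
      rw [this]
      exact J.add_mem (hJ2 i _ hj) hj
    · simp only [Set.mem_setOf_eq]
      rw [Fadd, Fsq, add_comm w, vv_add_self]; exact J.zero_mem
  have hmem : ∀ x, x ∈ J ⊔ Submodule.span (ZMod 2) {w} → x ∈ J ∨ ∃ y ∈ J, x = y + w := by
    intro x hx
    obtain ⟨y, hy, z, hz, rfl⟩ := Submodule.mem_sup.mp hx
    obtain ⟨a, rfl⟩ := Submodule.mem_span_singleton.mp hz
    rcases z2_cases a with rfl | rfl
    · left; simpa using hy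
    · right; exact ⟨y, hy, by simp⟩
  have hwin : w ∈ J ⊔ Submodule.span (ZMod 2) {w} :=
    (le_sup_right : _ ≤ J ⊔ _) (Submodule.mem_span_singleton_self w)
  have hJle : ∀ y ∈ J, y ∈ J ⊔ Submodule.span (ZMod 2) {w} := fun y hy =>
    (le_sup_left : J ≤ J ⊔ _) hy
  refine hmax (J ⊔ Submodule.span (ZMod 2) {w}) ⟨?_, ?_⟩ ?_
  · intro u hu v hv
    replace hu := hmem u hu
    replace hv := hmem v hv
    rcases hu with hu | ⟨u, hu, rfl⟩ <;> rcases hv with hv | ⟨v, hv, rfl⟩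
    · exact hJ1 u hu v hv
    · rw [sympl_add_right, hJ1 u hu v hv, sympl_comm, hw1 u hu, add_zero]
    · rw [sympl_add_left, hJ1 u hu v hv, hw1 v hv, add_zero]
    · rw [sympl_add_right, sympl_add_left, sympl_add_left, hJ1 u hu v hv, hw1 v hv, sympl_self,
        sympl_comm, hw1 u hu]; simp
  · intro i x hx
    replace hx := hmem x hx
    rcases hx with hx | ⟨x, hx, rfl⟩
    · exact hJle _ (hJ2 i x hx)
    · have : F i (x + w) = F i x + (F i w + w) + w := by
        rw [Fadd, add_assoc, add_assoc, vv_add_self, add_zero]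
      rw [this]
      exact Submodule.add_mem _ (hJle _ (J.add_mem (hJ2 i x hx) (hfix i))) hwin
  · exact lt_of_le_of_ne le_sup_left (fun h => hw2 (h ▸ hwin))

theorem stmt16 {m : ℕ} (hm : 1 ≤ m) (C : Matrix (V m) (V m) ℂ) (hC : C ∈ CH m 2) :
    ∃ J1 J2 : Submodule (ZMod 2) (V m × V m),
      (∀ u ∈ J1, ∀ v ∈ J1, sympl u v = 0) ∧
      (∀ w : V m × V m, (∀ v ∈ J1, sympl w v = 0) → w ∈ J1) ∧
      (∀ u ∈ J2, ∀ v ∈ J2, sympl u v = 0) ∧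
      (∀ w : V m × V m, (∀ v ∈ J2, sympl w v = 0) → w ∈ J2) ∧
      (fun M => C * M * Cᴴ) ''
          ((Submodule.span ℂ (EM '' (J1 : Set (V m × V m))) :
            Submodule ℂ (Matrix (V m) (V m) ℂ)) : Set (Matrix (V m) (V m) ℂ)) =
        ((Submodule.span ℂ (EM '' (J2 : Set (V m × V m))) :
            Submodule ℂ (Matrix (V m) (V m) ℂ)) : Set (Matrix (V m) (V m) ℂ)) := by
  obtain ⟨hU, hC2⟩ := hC
  have hU1 : Cᴴ * C = 1 := Matrix.mem_unitaryGroup_iff'.mp hU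
  have hU2 : C * Cᴴ = 1 := Matrix.mem_unitaryGroup_iff.mp hU
  -- conjugation by `C`
  let T : Matrix (V m) (V m) ℂ → Matrix (V m) (V m) ℂ := fun M => C * M * Cᴴ
  have Tmul : ∀ A B, T A * T B = T (A * B) := by
    intro A B
    calc T A * T B = C * A * (Cᴴ * C) * B * Cᴴ := by simp only [T, mul_assoc]
      _ = T (A * B) := by rw [hU1]; simp only [T, mul_assoc, mul_one]
  have Tsmul : ∀ (z : ℂ) A, T (z • A) = z • T A := by
    intro z A; simp only [T, Matrix.mul_smul, Matrix.smul_mul]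
  have T1 : T 1 = 1 := by simp only [T, mul_one, hU2]
  let T' : Matrix (V m) (V m) ℂ → Matrix (V m) (V m) ℂ := fun M => Cᴴ * M * C
  have TT' : ∀ A, T (T' A) = A := by
    intro A
    calc T (T' A) = (C * Cᴴ) * A * (C * Cᴴ) := by simp only [T, T', mul_assoc]
      _ = A := by rw [hU2, one_mul, mul_one]
  have T'T : ∀ A, T' (T A) = A := by
    intro A
    calc T' (T A) = (Cᴴ * C) * A * (Cᴴ * C) := by simp only [T, T', mul_assoc]
      _ = A := by rw [hU1, one_mul, mul_one]
  have Tinj : ∀ A B, T A = T B → A = B := fun A B h => by rw [← T'T A, h, T'T]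
  have Tadd : ∀ A B, T (A + B) = T A + T B := by
    intro A B; simp only [T, mul_add, add_mul]
  -- the Cliffords
  let G : V m × V m → Matrix (V m) (V m) ℂ := fun c => T (EM c)
  have Gsq : ∀ c, G c * G c = 1 := by
    intro c; simp only [G, Tmul, EM_sq, T1]
  have GF : ∀ c d, ∃ p : ℂ × (V m × V m), p.1 ≠ 0 ∧ G c * EM d * G c = p.1 • EM p.2 := by
    intro c d
    have h := hC2 (EM c) (EM_mem_HW c)
    obtain ⟨hu, hw⟩ := h
    have h1 : G c * (G c)ᴴ = 1 := Matrix.mem_unitaryGroup_iff.mp hu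
    have h2 : (G c)ᴴ = G c := by
      calc (G c)ᴴ = (G c * G c) * (G c)ᴴ := by rw [Gsq, one_mul]
        _ = G c := by rw [mul_assoc, h1, mul_one]
    obtain ⟨z, e, hz, he⟩ := HW_eq (hw (EM d) (EM_mem_HW d))
    refine ⟨(z, e), hz, ?_⟩
    rw [← he]
    conv_lhs => rw [← h2]
    change (G c)ᴴ * EM d * (G c)ᴴ = G c * EM d * (G c)ᴴ
    rw [h2]
  choose p hp0 hp using GF
  let F : V m × V m → V m × V m → V m × V m := fun c d => (p c d).2
  have hF : ∀ c d, G c * EM d * G c = (p c d).1 • EM (F c d) := hp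
  have Gmul : ∀ c A B, (G c * A * G c) * (G c * B * G c) = G c * (A * B) * G c := by
    intro c A B
    calc (G c * A * G c) * (G c * B * G c) = G c * A * (G c * G c) * B * G c := by
          simp only [mul_assoc]
      _ = _ := by rw [Gsq]; simp only [mul_assoc, mul_one]
  have Gcomm : ∀ c d, G c * G d = sg (sympl c d) • (G d * G c) := by
    intro c d
    simp only [G, Tmul]
    rw [EM_comm, Tsmul]
  have Fadd : ∀ c x y, F c (x + y) = F c x + F c y := by
    intro c x y
    obtain ⟨z, hz, h1⟩ := EM_mul x y
    obtain ⟨w, hw, h2⟩ := EM_mul (F c x) (F c y)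
    have h3 := Gmul c (EM x) (EM y)
    rw [hF, hF, h1, Matrix.smul_mul, Matrix.mul_smul, h2, Matrix.mul_smul, Matrix.smul_mul, hF,
      smul_smul, smul_smul, smul_smul] at h3
    exact EM_inj (mul_ne_zero hz (hp0 _ _)) h3.symm
  have Fsym : ∀ c x y, sympl (F c x) (F c y) = sympl x y := by
    intro c x y
    have hne : EM (F c y) * EM (F c x) ≠ 0 := by
      obtain ⟨z, hz, h⟩ := EM_mul (F c y) (F c x)
      rw [h]; exact smul_ne_zero hz (EM_ne _)
    have h1 := Gmul c (EM x) (EM y)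
    have h2 := Gmul c (EM y) (EM x)
    rw [EM_comm, Matrix.mul_smul, Matrix.smul_mul, ← h2, hF, hF] at h1
    simp only [Matrix.smul_mul, Matrix.mul_smul] at h1
    rw [EM_comm (F c x)] at h1
    simp only [smul_smul] at h1
    have h3 := smul_left_injective ℂ hne h1
    have h4 : sg (sympl (F c x) (F c y)) = sg (sympl x y) := by
      apply mul_left_cancel₀ (mul_ne_zero (hp0 c x) (hp0 c y))
      linear_combination h3
    have h5 : sympl (F c x) (F c y) + sympl x y = 0 := by
      apply sg_eq_one; rw [sg_add, h4, sg_sq]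
    exact CharTwo.add_eq_zero.mp h5
  have Fsq : ∀ c x, F c (F c x) = x := by
    intro c x
    have h1 : G c * (G c * EM x * G c) * G c = EM x := by
      calc G c * (G c * EM x * G c) * G c = (G c * G c) * EM x * (G c * G c) := by
            simp only [mul_assoc]
        _ = EM x := by rw [Gsq, one_mul, mul_one]
    rw [hF, Matrix.mul_smul, Matrix.smul_mul, hF, smul_smul, ← one_smul ℂ (EM x)] at h1
    exact EM_inj (mul_ne_zero (hp0 _ _) (hp0 _ _)) h1
  have Fcomm : ∀ c d x, F c (F d x) = F d (F c x) := by
    intro c d x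
    have h1 : G c * (G d * EM x * G d) * G c = G d * (G c * EM x * G c) * G d := by
      calc G c * (G d * EM x * G d) * G c = (G c * G d) * EM x * (G d * G c) := by
            simp only [mul_assoc]
        _ = (G d * G c) * EM x * (G c * G d) := by
            rw [Gcomm c d]; simp only [Matrix.smul_mul, Matrix.mul_smul]
        _ = _ := by simp only [mul_assoc]
    rw [hF, hF, Matrix.mul_smul, Matrix.smul_mul, hF, smul_smul, Matrix.mul_smul, Matrix.smul_mul,
      hF, smul_smul] at h1
    exact EM_inj (mul_ne_zero (hp0 _ _) (hp0 _ _)) h1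
  obtain ⟨J2, hJ1, hJ2, hJinv⟩ := exists_invariant F Fadd Fsym Fsq Fcomm
  have hspan := mem_span_iff J2 hJ1 hJ2
  set 𝒜 := Submodule.span ℂ (EM '' (J2 : Set (V m × V m))) with h𝒜
  -- multiplicativity and commutativity of the algebra
  have Amul : ∀ A ∈ 𝒜, ∀ B ∈ 𝒜, A * B ∈ 𝒜 := by
    intro A hA B hB
    rw [hspan] at *
    intro j hj
    have : cj j (A * B) = cj j A * cj j B := by
      calc cj j (A * B) = EM j * A * 1 * B * EM j := by simp only [cj, mul_assoc, one_mul]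
        _ = _ := by rw [← EM_sq j]; simp only [cj, mul_assoc]
    rw [this, hA j hj, hB j hj]
  have Acomm : ∀ A ∈ 𝒜, ∀ B ∈ 𝒜, A * B = B * A := by
    intro A hA B hB
    rw [hspan] at hA
    rw [h𝒜] at hB
    induction hB using Submodule.span_induction with
    | mem x hx =>
      obtain ⟨c, hc, rfl⟩ := hx
      have := congrArg (EM c * ·) (hA c hc)
      simp only [cj, ← mul_assoc, EM_sq, one_mul] at this
      exact this
    | zero => simp
    | add x y _ _ hx hy => rw [mul_add, add_mul, hx, hy]
    | smul a x _ hx => rw [Matrix.mul_smul, Matrix.smul_mul, hx]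
  have Ginv : ∀ c, ∀ A ∈ 𝒜, G c * A * G c ∈ 𝒜 := by
    intro c A hA
    rw [h𝒜] at hA
    induction hA using Submodule.span_induction with
    | mem x hx =>
      obtain ⟨d, hd, rfl⟩ := hx
      rw [hF]
      exact 𝒜.smul_mem _ (Submodule.subset_span ⟨_, hJinv c d hd, rfl⟩)
    | zero => simp
    | add x y _ _ hx hy => rw [mul_add, add_mul]; exact 𝒜.add_mem hx hy
    | smul a x _ hx => rw [Matrix.mul_smul, Matrix.smul_mul]; exact 𝒜.smul_mem _ hx
  let J1 : Submodule (ZMod 2) (V m × V m) :=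
    { carrier := {c | T (EM c) ∈ 𝒜}
      zero_mem' := by
        simp only [Set.mem_setOf_eq, EM_zero, T1]
        rw [← EM_zero]
        exact Submodule.subset_span ⟨0, J2.zero_mem, rfl⟩
      add_mem' := by
        intro a b ha hb
        simp only [Set.mem_setOf_eq] at *
        obtain ⟨z, hz, h⟩ := EM_mul a b
        have h1 := Amul _ ha _ hb
        rw [Tmul, h, Tsmul] at h1
        exact (𝒜.smul_mem_iff hz).mp h1
      smul_mem' := by
        intro a x hx
        rcases z2_cases a with rfl | rfl
        · simp only [Set.mem_setOf_eq, zero_smul, EM_zero, T1]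
          rw [← EM_zero]
          exact Submodule.subset_span ⟨0, J2.zero_mem, rfl⟩
        · simpa using hx }
  have memJ1 : ∀ c, c ∈ J1 ↔ T (EM c) ∈ 𝒜 := fun c => Iff.rfl
  -- every element of the pulled back algebra lies in the span of `J1`
  have hpull : ∀ X, T X ∈ 𝒜 → X ∈ Submodule.span ℂ (EM '' (J1 : Set (V m × V m))) := by
    intro X hX
    apply mem_of_PP
    intro c
    obtain ⟨z, hz⟩ := PP_scalar c X
    have hTP : T (PP c X) ∈ 𝒜 := by
      have : T (PP c X) = ∑ d, sg (sympl c d) • (G d * T X * G d) := by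
        have h1 : ∀ d, G d * T X * G d = T (cj d X) := by
          intro d; simp only [G, Tmul, cj]
        simp only [h1, ← Tsmul]
        simp only [T, PP, Finset.mul_sum, Finset.sum_mul]
      rw [this]
      exact 𝒜.sum_mem (fun d _ => 𝒜.smul_mem _ (Ginv d _ hX))
    rw [hz] at hTP ⊢
    by_cases h0 : z = 0
    · rw [h0, zero_smul]; exact Submodule.zero_mem _
    · rw [Tsmul, 𝒜.smul_mem_iff h0] at hTP
      exact Submodule.smul_mem _ _ (Submodule.subset_span ⟨c, hTP, rfl⟩)
  refine ⟨J1, J2, ?_, ?_, hJ1, hJ2, ?_⟩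
  · intro u hu v hv
    have h1 := Acomm _ ((memJ1 u).mp hu) _ ((memJ1 v).mp hv)
    rw [Tmul, Tmul] at h1
    have h2 := Tinj _ _ h1
    rw [EM_comm] at h2
    have hne : EM v * EM u ≠ 0 := by
      obtain ⟨z, hz, h⟩ := EM_mul v u
      rw [h]; exact smul_ne_zero hz (EM_ne _)
    apply sg_eq_one
    apply smul_left_injective ℂ hne
    simp only [one_smul]; exact h2
  · intro w hw
    rw [memJ1, hspan]
    intro j hj
    have hj' : EM j ∈ 𝒜 := Submodule.subset_span ⟨j, hj, rfl⟩
    have h1 := hpull (T' (EM j)) (by rw [TT']; exact hj')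
    have h2 : EM w * T' (EM j) = T' (EM j) * EM w := by
      generalize T' (EM j) = Y at h1
      induction h1 using Submodule.span_induction with
      | mem x hx =>
        obtain ⟨c, hc, rfl⟩ := hx
        rw [EM_comm, hw c hc, sg_zero, one_smul]
      | zero => simp
      | add x y _ _ hx hy => rw [mul_add, add_mul, hx, hy]
      | smul a x _ hx => rw [Matrix.mul_smul, Matrix.smul_mul, hx]
    have h3 := congrArg T h2
    rw [← Tmul (EM w) (T' (EM j)), ← Tmul (T' (EM j)) (EM w), TT'] at h3
    rw [cj, ← h3, mul_assoc, EM_sq, mul_one]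
  · ext M
    constructor
    · rintro ⟨X, hX, rfl⟩
      change T X ∈ 𝒜
      have hX' : X ∈ Submodule.span ℂ (EM '' (J1 : Set (V m × V m))) := hX
      clear hX
      induction hX' using Submodule.span_induction with
      | mem x hx =>
        obtain ⟨c, hc, rfl⟩ := hx
        exact hc
      | zero => simp [T]
      | add x y _ _ hx hy => rw [Tadd]; exact 𝒜.add_mem hx hy
      | smul a x _ hx => rw [Tsmul]; exact 𝒜.smul_mem _ hx
    · intro hM
      have hM' : M ∈ 𝒜 := hM
      exact ⟨T' M, hpull _ (by rw [TT']; exact hM'), TT' M⟩
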